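/- arXiv:2402.02403 — 2 statements merged into one kernel-verified Lean document; each statement's English description precedes it below -/
import Mathlib

section
/- There is a universal constant c > 0 with the following property. For every finite connected simple graph G = (V, E) and every set P of pairwise disjoint unordered pairs of vertices of G (no vertex belongs to two pairs), there exist matchings M_1, …, M_m of G with m ≤ c · rt(G) such that every pair in P is served by the sequence M_1, …, M_m, and the composition (in order) of all the associated swap permutations is the identity permutation of V. (This is the combinatorial core of the theorem doh(G) = O(rt(G)): one layer of two-qubit gates can be made G-compliant with depth overhead O(rt(G)).) -/
/-- A routing round on `G`: the swap permutation of a matching of `G`, i.e. an involution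
of the vertices that moves vertices only along edges of `G`. -/
def isRound {V : Type*} (G : SimpleGraph V) (σ : Equiv.Perm V) : Prop :=
  σ * σ = 1 ∧ ∀ v : V, σ v ≠ v → G.Adj v (σ v)

/-- Composition, in order, of a list of round permutations: for `L = [σ₁, …, σₘ]`,
`rComp L = σₘ ∘ ⋯ ∘ σ₁`. -/
def rComp {V : Type*} (L : List (Equiv.Perm V)) : Equiv.Perm V :=
  L.foldl (fun p σ => σ * p) 1

/-- `rt(G, π)`: the minimum number of routing rounds (matchings of `G`) whose swap
permutations, composed in order, realize the permutation `π`. -/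
noncomputable def rtP {V : Type*} (G : SimpleGraph V) (π : Equiv.Perm V) : ℕ :=
  sInf {m | ∃ L : List (Equiv.Perm V), L.length = m ∧ (∀ σ ∈ L, isRound G σ) ∧ rComp L = π}

/-- `rt(G)`: the routing number of `G`, the maximum of `rt(G, π)` over all permutations. -/
noncomputable def rt {V : Type*} [Fintype V] [DecidableEq V] (G : SimpleGraph V) : ℕ :=
  Finset.univ.sup (rtP G)

/-- The position permutation after `t` rounds of the sequence `L`: `π_t = σ_t ∘ ⋯ ∘ σ_1`. -/
def rPos {V : Type*} (L : List (Equiv.Perm V)) (t : ℕ) : Equiv.Perm V :=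
  rComp (L.take t)

/-- The pair `x, y` of pebbles is at adjacent positions at some time during `L`. -/
def Serves {V : Type*} (G : SimpleGraph V) (L : List (Equiv.Perm V)) (x y : V) : Prop :=
  ∃ t ≤ L.length, G.Adj (rPos L t x) (rPos L t y)

section Rounds

variable {V : Type*} {G : SimpleGraph V}

lemma rComp_append (L L' : List (Equiv.Perm V)) : rComp (L ++ L') = rComp L' * rComp L := by
  induction L' using List.reverseRecOn with
  | nil => simp [rComp]
  | append_singleton l σ ih =>
    have h (K : List (Equiv.Perm V)) : rComp (K ++ [σ]) = σ * rComp K := by simp [rComp]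
    rw [← List.append_assoc, h, h, ih, mul_assoc]

lemma rComp_singleton (σ : Equiv.Perm V) : rComp [σ] = σ := by simp [rComp]

lemma rComp_reverse {L : List (Equiv.Perm V)} (hL : ∀ σ ∈ L, isRound G σ) :
    rComp L.reverse * rComp L = 1 := by
  induction L with
  | nil => simp [rComp]
  | cons σ l ih =>
    have h : rComp (σ :: l) = rComp l * σ := by
      rw [← List.singleton_append, rComp_append, rComp_singleton]
    rw [List.reverse_cons, rComp_append, rComp_singleton, h, mul_assoc, ← mul_assoc (rComp _),
      ih fun τ hτ => hL τ (List.mem_cons_of_mem _ hτ), one_mul]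
    exact (hL σ List.mem_cons_self).1

lemma rPos_succ (L : List (Equiv.Perm V)) {t : ℕ} (ht : t < L.length) :
    rPos L (t + 1) = L[t] * rPos L t := by
  rw [rPos, rPos, List.take_succ_eq_append_getElem ht, rComp_append, rComp_singleton]

lemma Serves.append_right {L : List (Equiv.Perm V)} {x y : V} (h : Serves G L x y)
    (L' : List (Equiv.Perm V)) : Serves G (L ++ L') x y := by
  obtain ⟨t, ht, h⟩ := h
  refine ⟨t, by simp; omega, ?_⟩
  rwa [rPos, List.take_append_of_le_length ht]

lemma Serves.append_left {L L' : List (Equiv.Perm V)} {x y : V}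
    (h : Serves G L' (rComp L x) (rComp L y)) : Serves G (L ++ L') x y := by
  obtain ⟨t, ht, h⟩ := h
  refine ⟨L.length + t, by simpa using ht, ?_⟩
  rwa [rPos, List.take_length_add_append, rComp_append]

lemma Serves.append_of_rComp_eq_one {L L' : List (Equiv.Perm V)} (hL : rComp L = 1) {x y : V}
    (h : Serves G L' x y) : Serves G (L ++ L') x y :=
  Serves.append_left (by simpa [hL] using h)

lemma isRound_swap [DecidableEq V] {x y : V} (h : G.Adj x y) : isRound G (Equiv.swap x y) := by
  refine ⟨Equiv.swap_mul_self x y, fun v hv => ?_⟩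
  by_cases hx : v = x
  · subst hx; simpa using h
  by_cases hy : v = y
  · subst hy; simpa using h.symm
  exact absurd (Equiv.swap_apply_of_ne_of_ne hx hy) hv

lemma exists_perm_forall_ne [Fintype V] [Nontrivial V] : ∃ π : Equiv.Perm V, ∀ x, π x ≠ x := by
  let e := Fintype.equivFin V
  refine ⟨e.trans ((finRotate _).trans e.symm), fun x hx => ?_⟩
  have h := support_finRotate_of_le (n := Fintype.card V) Fintype.one_lt_card
  have hmem : e x ∈ (finRotate (Fintype.card V)).support := h ▸ Finset.mem_univ _
  rw [Equiv.Perm.mem_support] at hmem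
  exact hmem ((Equiv.symm_apply_eq e).1 hx)

end Rounds

section RoutingNumber

variable {V : Type*} [Fintype V] [DecidableEq V] {G : SimpleGraph V}

lemma exists_rComp_eq (hG : G.Connected) (π : Equiv.Perm V) :
    ∃ L : List (Equiv.Perm V), (∀ σ ∈ L, isRound G σ) ∧ rComp L = π := by
  let S : Set (Equiv.Perm V) := {σ | ∃ x y, G.Adj x y ∧ σ = Equiv.swap x y}
  have hS : ∀ σ ∈ S, σ.IsSwap := by
    rintro σ ⟨x, y, h, rfl⟩
    exact ⟨x, y, h.ne, rfl⟩
  have : MulAction.IsPretransitive (Subgroup.closure S) V := by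
    refine ⟨fun x y => ?_⟩
    obtain ⟨w⟩ := hG.preconnected x y
    induction w with
    | nil => exact ⟨1, one_smul _ _⟩
    | @cons x z y h _ ih =>
      obtain ⟨g, hg⟩ := ih
      refine ⟨g * ⟨Equiv.swap x z, Subgroup.subset_closure ⟨x, z, h, rfl⟩⟩, ?_⟩
      rw [mul_smul, ← hg]
      congr 1
      exact Equiv.swap_apply_left x z
  have hπ : π ∈ Subgroup.closure S := by
    rw [closure_of_isSwap_of_isPretransitive hS]
    trivial
  induction hπ using Subgroup.closure_induction with
  | mem σ h =>
    obtain ⟨x, y, h, rfl⟩ := h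
    exact ⟨[Equiv.swap x y], by simpa using isRound_swap h, rComp_singleton _⟩
  | one => exact ⟨[], by simp, rfl⟩
  | mul σ τ _ _ h h' =>
    obtain ⟨L, hL, rfl⟩ := h
    obtain ⟨L', hL', rfl⟩ := h'
    refine ⟨L' ++ L, fun σ hσ => ?_, rComp_append _ _⟩
    exact (List.mem_append.1 hσ).elim (hL' σ) (hL σ)
  | inv σ _ h =>
    obtain ⟨L, hL, rfl⟩ := h
    exact ⟨L.reverse, by simpa using hL, eq_inv_of_mul_eq_one_left (rComp_reverse hL)⟩

lemma exists_routing (hG : G.Connected) (π : Equiv.Perm V) :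
    ∃ L : List (Equiv.Perm V), (∀ σ ∈ L, isRound G σ) ∧ L.length ≤ rt G ∧ rComp L = π := by
  obtain ⟨L₀, hL₀, h₀⟩ := exists_rComp_eq hG π
  obtain ⟨L, hlen, hL, h⟩ := Nat.sInf_mem
    (s := {m | ∃ L : List (Equiv.Perm V),
      L.length = m ∧ (∀ σ ∈ L, isRound G σ) ∧ rComp L = π}) ⟨_, L₀, rfl, hL₀, h₀⟩
  exact ⟨L, hL, hlen.trans_le (Finset.le_sup (f := rtP G) (Finset.mem_univ π)), h⟩

/-- Recording the first move of every pebble while routing a fixed-point-free permutation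
assigns to each vertex a neighbour so that every vertex is chosen at most `rt G` times. -/
lemma exists_neighbor_slot [Nontrivial V] (hG : G.Connected) :
    ∃ (f : V → V) (t : V → ℕ), (∀ x, G.Adj x (f x)) ∧ (∀ x, t x < rt G) ∧
      ∀ x y, f x = f y → t x = t y → x = y := by
  obtain ⟨π, hπ⟩ := exists_perm_forall_ne (V := V)
  obtain ⟨L, hL, hlen, rfl⟩ := exists_routing hG π
  have hmove (x : V) : ∃ t < L.length, rPos L t x = x ∧ rPos L (t + 1) x ≠ x := by
    by_contra! H
    have hstay (t : ℕ) (ht : t ≤ L.length) : rPos L t x = x := by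
      induction t with
      | zero => rfl
      | succ t ih => exact H t ht (ih (by omega))
    exact hπ x (by simpa [rPos] using hstay L.length le_rfl)
  choose t ht hstay hmove using hmove
  refine ⟨fun x => rPos L (t x + 1) x, t, fun x => ?_, fun x => (ht x).trans_le hlen, ?_⟩
  · have hne := hmove x
    have hs : rPos L (t x + 1) x = (L[t x]'(ht x)) x := by
      rw [rPos_succ L (ht x), Equiv.Perm.mul_apply, hstay]
    rw [hs] at hne
    beta_reduce
    rw [hs]
    exact (hL _ (List.getElem_mem _)).2 x hne
  · intro x y hf hxy
    simp only [hxy] at hf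
    exact (rPos L (t y + 1)).injective hf

end RoutingNumber

section DisjointPairs

variable {V : Type*}

lemma injective_sumElim_cons {n : ℕ} {a b : Fin n → V} {x y : V}
    (h : Function.Injective (Sum.elim a b)) (hxy : x ≠ y) (hx : x ∉ Set.range (Sum.elim a b))
    (hy : y ∉ Set.range (Sum.elim a b)) :
    Function.Injective
      (Sum.elim (Fin.cons x a : Fin (n + 1) → V) (Fin.cons y b : Fin (n + 1) → V)) := by
  simp only [Set.Sum.elim_range, Set.mem_union, not_or] at hx hy
  rw [Sum.elim_injective] at h ⊢
  obtain ⟨ha, hb, hab⟩ := h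
  refine ⟨Fin.cons_injective_iff.2 ⟨hx.1, ha⟩, Fin.cons_injective_iff.2 ⟨hy.2, hb⟩, ?_⟩
  intro i j
  refine Fin.cases ?_ (fun i => ?_) i <;> refine Fin.cases ?_ (fun j => ?_) j
  · simpa using hxy
  · exact fun e => hx.2 ⟨j, by simpa using e.symm⟩
  · exact fun e => hy.1 ⟨i, by simpa using e⟩
  · simpa using hab i j

/-- All but one element of each fibre of `f` on `I` can be grouped into disjoint pairs lying
in a common fibre. -/
lemma exists_fiber_pairs [DecidableEq V] (f : V → V) (I : Finset V) :
    ∃ (q : ℕ) (a b : Fin q → V), Function.Injective (Sum.elim a b) ∧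
      (∀ i, a i ∈ I ∧ b i ∈ I ∧ f (a i) = f (b i)) ∧ I.card ≤ 2 * q + (I.image f).card := by
  induction I using Finset.strongInduction with
  | H I ih =>
  by_cases hinj : Set.InjOn f I
  · exact ⟨0, Fin.elim0, Fin.elim0, fun x => x.elim (·.elim0) (·.elim0), fun i => i.elim0,
      by simp [Finset.card_image_of_injOn hinj]⟩
  simp only [Set.InjOn] at hinj
  push Not at hinj
  obtain ⟨x, hx, y, hy, hf, hxy⟩ := hinj
  have hsub : (I.erase x).erase y ⊆ I :=
    (Finset.erase_subset _ _).trans (Finset.erase_subset _ _)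
  have hcard : ((I.erase x).erase y).card + 2 = I.card := by
    have h₁ := Finset.card_erase_add_one hx
    have h₂ := Finset.card_erase_add_one (Finset.mem_erase.2 ⟨hxy.symm, hy⟩)
    omega
  obtain ⟨q, a, b, hab, hmem, hq⟩ := ih _ (Finset.ssubset_of_subset_of_ssubset
    (Finset.erase_subset _ _) (Finset.erase_ssubset hx))
  have himg := Finset.card_le_card (Finset.image_subset_image (f := f) hsub)
  have hr : ∀ z ∈ Set.range (Sum.elim a b), z ∈ (I.erase x).erase y := by
    rintro _ ⟨i | i, rfl⟩
    exacts [(hmem i).1, (hmem i).2.1]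
  refine ⟨q + 1, Fin.cons x a, Fin.cons y b, injective_sumElim_cons hab hxy
    (fun h => by simpa using hr x h) (fun h => by simpa using hr y h), fun i => ?_, by omega⟩
  refine Fin.cases ⟨hx, hy, hf⟩ (fun i => ?_) i
  obtain ⟨h₁, h₂, h₃⟩ := hmem i
  exact ⟨hsub h₁, hsub h₂, h₃⟩

lemma exists_maximal_matching [Fintype V] (G : SimpleGraph V) :
    ∃ (p : ℕ) (a b : Fin p → V), Function.Injective (Sum.elim a b) ∧
      (∀ i, G.Adj (a i) (b i)) ∧
      ∀ x y, x ∉ Set.range (Sum.elim a b) → y ∉ Set.range (Sum.elim a b) → ¬ G.Adj x y := by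
  let P (p : ℕ) : Prop := ∃ a b : Fin p → V, Function.Injective (Sum.elim a b) ∧
    ∀ i, G.Adj (a i) (b i)
  have hmax : ∃ p, P p ∧ ¬ P (p + 1) := by
    by_contra! H
    have hall (p : ℕ) : P p := by
      induction p with
      | zero => exact ⟨Fin.elim0, Fin.elim0, fun x => x.elim (·.elim0) (·.elim0),
          fun i => i.elim0⟩
      | succ p ih => exact H p ih
    obtain ⟨a, b, hab, -⟩ := hall (Fintype.card V + 1)
    have := Fintype.card_le_of_injective _ hab
    simp only [Fintype.card_sum, Fintype.card_fin] at this
    omega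
  obtain ⟨p, ⟨a, b, hab, hadj⟩, hp⟩ := hmax
  refine ⟨p, a, b, hab, hadj, fun x y hx hy hxy => hp ⟨Fin.cons x a, Fin.cons y b,
    injective_sumElim_cons hab hxy.ne hx hy, Fin.cases hxy hadj⟩⟩

lemma exists_perm_map_eq [Finite V] {ι : Type*} {F H : ι → V} (hF : Function.Injective F)
    (hH : Function.Injective H) : ∃ π : Equiv.Perm V, ∀ i, π (F i) = H i := by
  classical
  have := Fintype.ofFinite V
  let e : {x // x ∈ Set.range F} ≃ {x // x ∈ Set.range H} :=
    (Equiv.ofInjective F hF).symm.trans (Equiv.ofInjective H hH)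
  refine ⟨e.extendSubtype, fun i => ?_⟩
  rw [Equiv.extendSubtype_apply_of_mem e (F i) ⟨i, rfl⟩]
  have : (Equiv.ofInjective F hF).symm ⟨F i, ⟨i, rfl⟩⟩ = i :=
    Equiv.ofInjective_symm_apply hF i
  simp [e, this]

lemma exists_round_of_pairs {G : SimpleGraph V} {ι : Type*} {x y : ι → V}
    (hinj : Function.Injective (Sum.elim x y)) (hadj : ∀ i, G.Adj (x i) (y i)) :
    ∃ σ : Equiv.Perm V, isRound G σ ∧ (∀ i, σ (x i) = y i) ∧
      ∀ z, (∀ i, z ≠ x i) → (∀ i, z ≠ y i) → σ z = z := by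
  let e : ι ⊕ ι ↪ V := ⟨Sum.elim x y, hinj⟩
  let σ : Equiv.Perm V := Equiv.Perm.viaEmbedding (Equiv.sumComm ι ι) e
  have hx (i : ι) : σ (x i) = y i := Equiv.Perm.viaEmbedding_apply _ e (Sum.inl i)
  have hy (i : ι) : σ (y i) = x i := Equiv.Perm.viaEmbedding_apply _ e (Sum.inr i)
  have hz (z : V) (hzx : ∀ i, z ≠ x i) (hzy : ∀ i, z ≠ y i) : σ z = z := by
    refine Equiv.Perm.viaEmbedding_apply_of_notMem _ e z ?_
    rintro ⟨i | i, h⟩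
    exacts [hzx i h.symm, hzy i h.symm]
  have hcases (z : V) : (∃ i, z = x i) ∨ (∃ i, z = y i) ∨ σ z = z := by
    by_contra! h
    exact h.2.2 (hz z h.1 h.2.1)
  refine ⟨σ, ⟨Equiv.ext fun z => ?_, fun z hne => ?_⟩, hx, hz⟩
  · rcases hcases z with ⟨i, rfl⟩ | ⟨i, rfl⟩ | h
    · simp [hx, hy]
    · simp [hx, hy]
    · simp [h]
  · rcases hcases z with ⟨i, rfl⟩ | ⟨i, rfl⟩ | h
    · rw [hx]; exact hadj i
    · rw [hy]; exact (hadj i).symm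
    · exact absurd h hne

end DisjointPairs

section Serving

variable {V : Type*} {G : SimpleGraph V}

/-- Pairs of leaves with a common centre are served by moving, in each slot, one leaf of every
star to its centre and back. -/
lemma exists_star_sweep {f : V → V} {t : V → ℕ} (hadj : ∀ x, G.Adj x (f x))
    (hinj : ∀ x y, f x = f y → t x = t y → x = y) {q : ℕ} {a b : Fin q → V}
    (hab : Function.Injective (Sum.elim a b)) (hf : ∀ i, f (a i) = f (b i))
    (ha : ∀ i j, f (a i) ≠ a j) (hb : ∀ i j, f (a i) ≠ b j) (R : ℕ) :
    ∃ L : List (Equiv.Perm V), (∀ σ ∈ L, isRound G σ) ∧ L.length = 2 * R ∧ rComp L = 1 ∧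
      ∀ i, t (a i) < R → Serves G L (a i) (b i) := by
  rw [Sum.elim_injective] at hab
  obtain ⟨hai, -, hne⟩ := hab
  induction R with
  | zero => exact ⟨[], by simp, rfl, rfl, fun i hi => absurd hi (Nat.not_lt_zero _)⟩
  | succ R ih =>
    obtain ⟨L, hL, hlen, hone, hserve⟩ := ih
    let ι := {i : Fin q // t (a i) = R}
    obtain ⟨σ, hσ, hmap, hfix⟩ := exists_round_of_pairs (G := G)
      (x := fun i : ι => a i) (y := fun i : ι => f (a i))
      (by
        rw [Sum.elim_injective]
        refine ⟨hai.comp Subtype.val_injective, fun i j h => ?_, fun i j => (ha j i).symm⟩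
        exact Subtype.ext (hai (hinj _ _ h (i.2.trans j.2.symm))))
      fun i => hadj _
    refine ⟨L ++ [σ, σ], fun τ hτ => ?_, by simp [hlen]; omega, ?_, fun i hi => ?_⟩
    · rcases List.mem_append.1 hτ with h | h
      · exact hL τ h
      · simp only [List.mem_cons, List.not_mem_nil, or_false, or_self] at h
        exact h ▸ hσ
    · rw [rComp_append, hone, mul_one]
      simpa [rComp] using hσ.1
    · rcases Nat.lt_succ_iff_lt_or_eq.1 hi with hi | hi
      · exact (hserve i hi).append_right _
      · refine Serves.append_of_rComp_eq_one hone ⟨1, by simp, ?_⟩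
        have h₁ : σ (a i) = f (a i) := hmap ⟨i, hi⟩
        have h₂ : σ (b i) = b i := hfix _ (fun j => (hne _ _).symm) fun j => (hb _ _).symm
        simp only [rPos, List.take_succ_cons, List.take_zero, rComp_singleton, h₁, h₂]
        rw [hf]
        exact (hadj _).symm

/-- If some closed sequence serves `q` disjoint pairs, then any block of `q` pairs can be served
by a closed sequence that is longer by at most `2 * rt G`. -/
lemma exists_serving_block [Fintype V] [DecidableEq V] (hG : G.Connected) {k q : ℕ}
    {u v : Fin k → V} (huv : Function.Injective (Sum.elim u v)) {a b : Fin q → V}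
    (hab : Function.Injective (Sum.elim a b)) {L₀ : List (Equiv.Perm V)}
    (hL₀ : ∀ σ ∈ L₀, isRound G σ) (hone : rComp L₀ = 1) (hserve : ∀ i, Serves G L₀ (a i) (b i))
    (s : ℕ) :
    ∃ L : List (Equiv.Perm V), (∀ σ ∈ L, isRound G σ) ∧ L.length ≤ L₀.length + 2 * rt G ∧
      rComp L = 1 ∧ ∀ i : Fin k, s ≤ i → i < s + q → Serves G L (u i) (v i) := by
  let ι := {i : Fin k // s ≤ i ∧ i < s + q}
  let g (i : ι) : Fin q := ⟨i.1 - s, by have := i.2; omega⟩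
  have hg : Function.Injective g := fun i j h => by
    have h' : (i.1 : ℕ) - s = j.1 - s := congrArg Fin.val h
    have := i.2
    have := j.2
    exact Subtype.ext (Fin.ext (by omega))
  obtain ⟨π, hπ⟩ := exists_perm_map_eq
    (huv.comp ((Subtype.val_injective (p := fun i : Fin k => s ≤ i ∧ i < s + q)).sumMap
      Subtype.val_injective)) (hab.comp (hg.sumMap hg))
  obtain ⟨K, hK, hlen, rfl⟩ := exists_routing hG π
  refine ⟨K ++ L₀ ++ K.reverse, ?_, by simp; omega, ?_, fun i hs hq => ?_⟩
  · simp only [List.mem_append, List.mem_reverse]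
    rintro σ ((h | h) | h)
    exacts [hK σ h, hL₀ σ h, hK σ h]
  · rw [rComp_append, rComp_append, hone, one_mul, rComp_reverse hK]
  · refine (Serves.append_left ?_).append_right _
    have hu : rComp K (u i) = a (g ⟨i, hs, hq⟩) := hπ (Sum.inl ⟨i, hs, hq⟩)
    have hv : rComp K (v i) = b (g ⟨i, hs, hq⟩) := hπ (Sum.inr ⟨i, hs, hq⟩)
    rw [hu, hv]
    exact hserve _

end Serving

/-- There is a universal constant `c > 0` such that for every finite connected graph `G` and
every collection of pairwise disjoint pairs `{u i, v i}` of vertices (all `2k` vertices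
distinct), there is a sequence of at most `c * rt G` matchings of `G` whose swap permutations
compose (in order) to the identity and which serves every pair, i.e. brings the pebbles of the
two members of each pair to adjacent vertices at some intermediate time. -/
theorem depth_overhead_upper_bound :
    ∃ c : ℕ, 0 < c ∧
      ∀ (V : Type) [Fintype V] [DecidableEq V] (G : SimpleGraph V), G.Connected →
        ∀ (k : ℕ) (u v : Fin k → V),
          Function.Injective (Sum.elim u v : Fin k ⊕ Fin k → V) →
          ∃ L : List (Equiv.Perm V),
            (∀ σ ∈ L, isRound G σ) ∧
            L.length ≤ c * rt G ∧
            rComp L = 1 ∧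
            ∀ i : Fin k, ∃ t ≤ L.length, G.Adj (rPos L t (u i)) (rPos L t (v i)) := by
  refine ⟨8, by norm_num, ?_⟩
  intro V _ _ G hG k u v huv
  rcases Nat.eq_zero_or_pos k with rfl | hk
  · exact ⟨[], by simp, by simp, rfl, fun i => i.elim0⟩
  have : Nontrivial V :=
    ⟨u ⟨0, hk⟩, v ⟨0, hk⟩, (Sum.elim_injective.1 huv).2.2 _ _⟩
  obtain ⟨f, t, hadj, ht, hinj⟩ := exists_neighbor_slot hG
  obtain ⟨p, a, b, hab, habadj, hmax⟩ := exists_maximal_matching G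
  let C : Finset V := Finset.univ.image (Sum.elim a b)
  have hC (x : V) : x ∈ C ↔ x ∈ Set.range (Sum.elim a b) := by simp [C]
  have hCcard : C.card = 2 * p := by
    simp [C, Finset.card_image_of_injective _ hab, two_mul]
  have hfC (x : V) (hx : x ∈ Cᶜ) : f x ∈ C := by
    by_contra h
    exact hmax x (f x) (by rwa [← hC, ← Finset.mem_compl]) (by rwa [← hC]) (hadj x)
  obtain ⟨q, c, d, hcd, hmem, hq⟩ := exists_fiber_pairs f Cᶜ
  have himg : (Cᶜ.image f).card ≤ C.card :=
    Finset.card_le_card (Finset.image_subset_iff.2 hfC)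
  have hcompl := Finset.card_add_card_compl C
  have hkV := Fintype.card_le_of_injective _ huv
  simp only [Fintype.card_sum, Fintype.card_fin] at hkV
  have hout {x y : V} (hx : x ∈ Cᶜ) (hy : y ∈ Cᶜ) : f x ≠ y := fun h =>
    Finset.mem_compl.1 hy (h ▸ hfC x hx)
  obtain ⟨S, hS, hSlen, hSone, hSserve⟩ := exists_star_sweep hadj hinj hcd
    (fun i => (hmem i).2.2) (fun i j => hout (hmem i).1 (hmem j).1)
    (fun i j => hout (hmem i).1 (hmem j).2.1) (rt G)
  have hM (i : Fin p) : Serves G [] (a i) (b i) := ⟨0, le_rfl, habadj i⟩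
  obtain ⟨L₁, hL₁, hlen₁, hone₁, hs₁⟩ :=
    exists_serving_block hG huv hab (L₀ := []) (by simp) rfl hM 0
  obtain ⟨L₂, hL₂, hlen₂, hone₂, hs₂⟩ :=
    exists_serving_block hG huv hab (L₀ := []) (by simp) rfl hM p
  obtain ⟨L₃, hL₃, hlen₃, hone₃, hs₃⟩ :=
    exists_serving_block hG huv hcd hS hSone (fun i => hSserve i (ht _)) (2 * p)
  refine ⟨L₁ ++ (L₂ ++ L₃), ?_, ?_, by simp [rComp_append, hone₁, hone₂, hone₃], fun i => ?_⟩
  · simp only [List.mem_append]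
    rintro σ (h | h | h)
    exacts [hL₁ σ h, hL₂ σ h, hL₃ σ h]
  · simp only [List.length_append, List.length_nil] at *
    omega
  · change Serves G _ _ _
    have hi := i.2
    by_cases h₁ : (i : ℕ) < p
    · exact (hs₁ i (Nat.zero_le _) (by omega)).append_right _
    refine Serves.append_of_rComp_eq_one hone₁ ?_
    by_cases h₂ : (i : ℕ) < 2 * p
    · exact (hs₂ i (by omega) (by omega)).append_right _
    exact Serves.append_of_rComp_eq_one hone₂ (hs₃ i (by omega) (by omega))
end

section
/- For every finite connected simple graph G on n vertices, rt(G) ≤ 3n. -/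
/-- `Routes G m π`: the permutation `π` is realized by exactly `m` routing rounds on `G`. -/
def Routes {V : Type*} (G : SimpleGraph V) (m : ℕ) (π : Equiv.Perm V) : Prop :=
  ∃ L : List (Equiv.Perm V), L.length = m ∧ (∀ σ ∈ L, isRound G σ) ∧ rComp L = π

theorem isRound_one {V : Type*} (G : SimpleGraph V) : isRound G 1 :=
  ⟨one_mul 1, fun _ hv => absurd rfl hv⟩

namespace Routes

variable {V : Type*} {G : SimpleGraph V}

theorem zero_iff {π : Equiv.Perm V} : Routes G 0 π ↔ π = 1 := by
  constructor
  · rintro ⟨L, hL, -, rfl⟩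
    rw [List.length_eq_zero_iff.mp hL]
    rfl
  · rintro rfl
    exact ⟨[], rfl, by simp, rfl⟩

theorem succ_iff {m : ℕ} {π : Equiv.Perm V} :
    Routes G (m + 1) π ↔ ∃ σ ρ, isRound G σ ∧ Routes G m ρ ∧ π = σ * ρ := by
  constructor
  · rintro ⟨L, hL, hr, rfl⟩
    obtain rfl | ⟨L, σ, rfl⟩ := L.eq_nil_or_concat
    · simp at hL
    · refine ⟨σ, rComp L, hr σ (by simp), ⟨L, by simpa using hL, fun τ hτ => hr τ (by simp [hτ]),
        rfl⟩, ?_⟩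
      simp [rComp]
  · rintro ⟨σ, ρ, hσ, ⟨L, hL, hr, rfl⟩, rfl⟩
    refine ⟨L ++ [σ], by simp [hL], ?_, by simp [rComp]⟩
    intro τ hτ
    obtain hτ | hτ := List.mem_append.mp hτ
    · exact hr τ hτ
    · rwa [List.mem_singleton.mp hτ]

theorem one (m : ℕ) : Routes G m 1 := by
  induction m with
  | zero => exact zero_iff.mpr rfl
  | succ m ih => exact succ_iff.mpr ⟨1, 1, isRound_one G, ih, (one_mul 1).symm⟩

theorem mul {k m : ℕ} {σ π : Equiv.Perm V} (hσ : Routes G k σ) (hπ : Routes G m π) :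
    Routes G (k + m) (σ * π) := by
  induction k generalizing σ with
  | zero =>
    rw [zero_iff.mp hσ]
    simpa using hπ
  | succ k ih =>
    obtain ⟨τ, ρ, hτ, hρ, rfl⟩ := succ_iff.mp hσ
    rw [Nat.add_right_comm, mul_assoc]
    exact succ_iff.mpr ⟨τ, ρ * π, hτ, ih hρ, rfl⟩

theorem mono {k m : ℕ} (h : k ≤ m) {π : Equiv.Perm V} (hπ : Routes G k π) : Routes G m π := by
  obtain ⟨j, rfl⟩ := Nat.exists_eq_add_of_le h
  simpa using hπ.mul (Routes.one j)

theorem of_isRound {σ : Equiv.Perm V} (hσ : isRound G σ) : Routes G 1 σ :=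
  succ_iff.mpr ⟨σ, 1, hσ, zero_iff.mpr rfl, (mul_one σ).symm⟩

end Routes

section Glue

variable {V ι : Type*} (c : V → ι)

/-- The permutation acting on each fiber of `c` by a given permutation of that fiber. -/
def fiberGlue (ρ : ∀ i, Equiv.Perm {v // c v = i}) : Equiv.Perm V :=
  (Equiv.sigmaFiberEquiv c).permCongr (Equiv.Perm.sigmaCongrRight ρ)

theorem fiberGlue_one : fiberGlue c 1 = 1 := rfl

theorem fiberGlue_mul (ρ τ : ∀ i, Equiv.Perm {v // c v = i}) :
    fiberGlue c (ρ * τ) = fiberGlue c ρ * fiberGlue c τ := by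
  unfold fiberGlue
  rw [← Equiv.permCongr_mul, Equiv.Perm.sigmaCongrRight_mul]

theorem isRound_fiberGlue {G : SimpleGraph V} {ρ : ∀ i, Equiv.Perm {v // c v = i}}
    (h : ∀ i, isRound (G.comap Subtype.val) (ρ i)) : isRound G (fiberGlue c ρ) := by
  refine ⟨?_, fun v hv => ?_⟩
  · rw [← fiberGlue_mul, show ρ * ρ = 1 from funext fun i => (h i).1, fiberGlue_one]
  · exact (h (c v)).2 ⟨v, rfl⟩ fun h' => hv (congrArg Subtype.val h')

theorem routes_fiberGlue {G : SimpleGraph V} {m : ℕ} {ρ : ∀ i, Equiv.Perm {v // c v = i}}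
    (h : ∀ i, Routes (G.comap Subtype.val) m (ρ i)) : Routes G m (fiberGlue c ρ) := by
  induction m generalizing ρ with
  | zero =>
    rw [show ρ = 1 from funext fun i => Routes.zero_iff.mp (h i), fiberGlue_one]
    exact Routes.one 0
  | succ m ih =>
    choose σ τ hσ hτ heq using fun i => Routes.succ_iff.mp (h i)
    rw [show ρ = σ * τ from funext heq, fiberGlue_mul]
    exact Routes.succ_iff.mpr ⟨_, _, isRound_fiberGlue c hσ, ih hτ, rfl⟩

theorem routes_of_fibers {G : SimpleGraph V} {m : ℕ} {π : Equiv.Perm V}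
    (hc : ∀ v, c (π v) = c v)
    (h : ∀ i, ∀ ρ : Equiv.Perm {v // c v = i}, Routes (G.comap Subtype.val) m ρ) :
    Routes G m π := by
  have key := routes_fiberGlue c (G := G) (m := m)
    (ρ := fun i => π.subtypePerm fun v => by rw [hc]) fun i => h i _
  convert key using 1
  ext v
  rfl

end Glue

/-- A partition of a graph into a root `z` and branches hanging from neighbours of `z`: every
other vertex `v` has a parent `par v` one level closer to `z`, and `c v` is the top vertex of
the branch containing `v`. -/
structure Branching {V : Type*} (G : SimpleGraph V) where
  z : V
  d : V → ℕ
  par : V → V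
  c : V → V
  d_root : d z = 0
  adj_par : ∀ v, v ≠ z → G.Adj v (par v)
  d_par : ∀ v, v ≠ z → d (par v) + 1 = d v
  c_root : c z = z
  c_top : ∀ v, v ≠ z → par v = z → c v = v
  c_par : ∀ v, v ≠ z → par v ≠ z → c (par v) = c v

namespace Branching

variable {V : Type*} {G : SimpleGraph V} (B : Branching G)

theorem d_pos {v : V} (hv : v ≠ B.z) : 0 < B.d v := by
  have := B.d_par v hv
  omega

theorem par_induction {P : V → Prop} (top : ∀ v, v ≠ B.z → B.par v = B.z → P v)
    (step : ∀ v, v ≠ B.z → B.par v ≠ B.z → P (B.par v) → P v) (v : V) (hv : v ≠ B.z) : P v := by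
  induction h : B.d v generalizing v with
  | zero => have := B.d_pos hv; omega
  | succ n ih =>
    by_cases hp : B.par v = B.z
    · exact top v hv hp
    · exact step v hv hp (ih _ hp (by have := B.d_par v hv; omega))

theorem par_c {v : V} (hv : v ≠ B.z) : B.c v ≠ B.z ∧ B.par (B.c v) = B.z := by
  refine B.par_induction (P := fun v => B.c v ≠ B.z ∧ B.par (B.c v) = B.z) ?_ ?_ v hv
  · intro v hv hp
    rw [B.c_top v hv hp]
    exact ⟨hv, hp⟩
  · intro v hv hp ih
    rwa [B.c_par v hv hp] at ih

theorem c_eq_z {v : V} : B.c v = B.z ↔ v = B.z :=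
  ⟨fun h => by_contra fun hv => (B.par_c hv).1 h, fun h => h ▸ B.c_root⟩

theorem c_c (v : V) : B.c (B.c v) = B.c v := by
  by_cases hv : v = B.z
  · rw [hv, B.c_root, B.c_root]
  · exact B.c_top _ (B.par_c hv).1 (B.par_c hv).2

theorem par_eq_z_iff {v : V} (hv : v ≠ B.z) : B.par v = B.z ↔ B.d v = 1 := by
  have h := B.d_par v hv
  constructor
  · intro hp
    rw [hp, B.d_root] at h
    omega
  · intro hd
    by_contra hp
    have := B.d_pos hp
    omega

theorem connected_branch {r : V} (hr : r ≠ B.z) (hne : Nonempty {v // B.c v = r}) :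
    (G.comap (Subtype.val : {v // B.c v = r} → V)).Connected := by
  obtain ⟨w, hw⟩ := hne
  have hrr : B.c r = r := by rw [← hw, B.c_c]
  have key : ∀ v, v ≠ B.z → ∀ hv : B.c v = r,
      (G.comap (Subtype.val : {v // B.c v = r} → V)).Reachable ⟨v, hv⟩ ⟨r, hrr⟩ := by
    refine B.par_induction ?_ ?_
    · intro v hv hp hc
      have : v = r := by rw [← hc, B.c_top v hv hp]
      subst this
      rfl
    · intro v hv hp ih hc
      have hc' : B.c (B.par v) = r := by rw [B.c_par v hv hp, hc]
      refine SimpleGraph.Reachable.trans (SimpleGraph.Adj.reachable ?_) (ih hc')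
      exact B.adj_par v hv
  have hz : ∀ v, B.c v = r → v ≠ B.z := by
    rintro v hv rfl
    exact hr (by rw [← hv, B.c_root])
  have : Nonempty {v // B.c v = r} := ⟨⟨r, hrr⟩⟩
  refine ⟨fun u v => ?_⟩
  exact (key u (hz u u.2) u.2).trans (key v (hz v v.2) v.2).symm

theorem dist_c_lt (hG : G.Connected) {v : V} (hv : v ≠ B.z) : G.dist (B.c v) v < B.d v := by
  refine B.par_induction (P := fun v => G.dist (B.c v) v < B.d v) ?_ ?_ v hv
  · intro v hv hp
    rw [B.c_top v hv hp, SimpleGraph.dist_self]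
    exact B.d_pos hv
  · intro v hv hp ih
    rw [B.c_par v hv hp] at ih
    have h1 := hG.dist_triangle (u := B.c v) (v := B.par v) (w := v)
    have h2 := SimpleGraph.dist_eq_one_iff_adj.mpr (B.adj_par v hv).symm
    have h3 := B.d_par v hv
    omega

end Branching

theorem SimpleGraph.Connected.exists_adj_dist_add_one {V : Type*} {G : SimpleGraph V}
    (hG : G.Connected) {z v : V} (hv : v ≠ z) :
    ∃ w, G.Adj v w ∧ G.dist z w + 1 = G.dist z v := by
  obtain ⟨p, hp⟩ := hG.exists_walk_length_eq_dist v z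
  cases p with
  | nil => exact absurd rfl hv
  | @cons _ w _ h q =>
    refine ⟨w, h, ?_⟩
    rw [SimpleGraph.Walk.length_cons] at hp
    have h1 := SimpleGraph.dist_le q
    have h2 := hG.dist_triangle (u := v) (v := w) (w := z)
    have h3 := SimpleGraph.dist_eq_one_iff_adj.mpr h
    rw [SimpleGraph.dist_comm (u := z), SimpleGraph.dist_comm (u := z)]
    omega

theorem SimpleGraph.Connected.exists_branching {V : Type*} {G : SimpleGraph V}
    (hG : G.Connected) (z : V) : ∃ B : Branching G, B.z = z ∧ B.d = G.dist z := by
  classical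
  choose! par hadj hdist using fun v (hv : v ≠ z) => hG.exists_adj_dist_add_one hv
  refine ⟨⟨z, G.dist z, par, fun v => par^[G.dist z v - 1] v, by simp, hadj, hdist, by simp,
    ?_, ?_⟩, rfl, rfl⟩
  · intro v hv hp
    have := hdist v hv
    rw [hp, SimpleGraph.dist_self] at this
    simp [← this]
  · intro v hv hp
    have h1 := hdist v hv
    have h2 := hG.pos_dist_of_ne (Ne.symm hp)
    rw [show G.dist z v - 1 = (G.dist z (par v) - 1) + 1 by omega, Function.iterate_succ_apply]

theorem SimpleGraph.Connected.exists_balanced_branching {V : Type*} [Fintype V] [DecidableEq V]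
    {G : SimpleGraph V} (hG : G.Connected) :
    ∃ B : Branching G, ∀ r, r ≠ B.z →
      2 * (Finset.univ.filter fun v => B.c v = r).card ≤ Fintype.card V := by
  have := hG.nonempty
  obtain ⟨z, -, hz⟩ := Finset.exists_min_image Finset.univ (fun z => ∑ v, G.dist z v)
    Finset.univ_nonempty
  obtain ⟨B, rfl, hd⟩ := hG.exists_branching z
  refine ⟨B, fun r hr => ?_⟩
  by_cases hrr : B.c r = r
  swap
  · rw [Finset.filter_false_of_mem, Finset.card_empty]
    · omega
    · intro v _ hv
      exact hrr (by rw [← hv, B.c_c])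
  have hadj : G.dist r B.z = 1 := by
    have h := (B.par_c hr).2
    rw [hrr] at h
    exact SimpleGraph.dist_eq_one_iff_adj.mpr (h ▸ B.adj_par r hr)
  have hsum : ∑ v, (G.dist r v + 2 * if B.c v = r then 1 else 0) ≤ ∑ v, (G.dist B.z v + 1) := by
    refine Finset.sum_le_sum fun v _ => ?_
    split_ifs with hv
    · have hvz : v ≠ B.z := by
        rintro rfl
        exact hr (by rw [← hv, B.c_root])
      have h := B.dist_c_lt hG hvz
      rw [hv, hd] at h
      omega
    · have := hG.dist_triangle (u := r) (v := B.z) (w := v)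
      omega
  have hmin := hz r (Finset.mem_univ r)
  rw [Finset.sum_add_distrib, Finset.sum_add_distrib, ← Finset.mul_sum, Finset.sum_boole] at hsum
  simp only [Finset.sum_const, Finset.card_univ, smul_eq_mul, mul_one, Nat.cast_id] at hsum
  omega

namespace Branching

variable {V : Type*} {G : SimpleGraph V} (B : Branching G)

section Pull

variable (x : V → V)

/-- `B.Pulls x v w`: under the colouring `x`, the pebble on `v` is already in its branch while the
pebble on the child `w` of `v` is not. -/
def Pulls (v w : V) : Prop :=
  v ≠ B.z ∧ x v = B.c v ∧ w ≠ B.z ∧ B.par w = v ∧ x w ≠ B.c w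

open Classical in
/-- Each vertex whose pebble is in its branch is swapped with one child whose pebble is not. -/
noncomputable def pullFun (v : V) : V :=
  if h : ∃ w, B.Pulls x v w then h.choose
  else if h : ∃ w, B.Pulls x (B.par v) w then if h.choose = v then B.par v else v
  else v

variable {x}

theorem Pulls.not_pulls {B : Branching G} {v w : V} (h : B.Pulls x v w) :
    ¬ ∃ u, B.Pulls x w u :=
  fun ⟨_, hu⟩ => h.2.2.2.2 hu.2.1

theorem pullFun_of_exists {v : V} (h : ∃ w, B.Pulls x v w) :
    B.pullFun x v = h.choose ∧ B.Pulls x v (B.pullFun x v) ∧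
      B.pullFun x (B.pullFun x v) = v := by
  have h1 : B.pullFun x v = h.choose := dif_pos h
  have h2 : B.Pulls x v (B.pullFun x v) := h1 ▸ h.choose_spec
  refine ⟨h1, h2, ?_⟩
  have hp := h2.2.2.2.1
  conv_lhs => rw [pullFun]
  rw [dif_neg h2.not_pulls]
  rw [dif_pos (by rw [hp]; exact h), if_pos, hp]
  have heq : ∀ u, u = v → ∀ h' : ∃ w, B.Pulls x u w, h'.choose = h.choose := by
    rintro _ rfl _
    rfl
  rw [heq _ hp, h1]

theorem pullFun_cases (v : V) :
    (B.Pulls x v (B.pullFun x v) ∧ B.pullFun x (B.pullFun x v) = v) ∨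
      (B.Pulls x (B.pullFun x v) v ∧ B.pullFun x (B.pullFun x v) = v) ∨ B.pullFun x v = v := by
  by_cases h : ∃ w, B.Pulls x v w
  · exact Or.inl (B.pullFun_of_exists h).2
  · by_cases h' : ∃ w, B.Pulls x (B.par v) w
    · by_cases hv : h'.choose = v
      · have h1 : B.pullFun x v = B.par v := by
          rw [pullFun, dif_neg h, dif_pos h', if_pos hv]
        have h2 := B.pullFun_of_exists h'
        have h3 : B.pullFun x (B.par v) = v := h2.1.trans hv
        have h4 := h2.2.1
        rw [h3] at h4
        rw [h1]
        exact Or.inr (Or.inl ⟨h4, h3⟩)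
      · right; right
        rw [pullFun, dif_neg h, dif_pos h', if_neg hv]
    · right; right
      rw [pullFun, dif_neg h, dif_neg h']

theorem pullFun_involutive : Function.Involutive (B.pullFun x) := by
  intro v
  obtain h | h | h := B.pullFun_cases (x := x) v
  · exact h.2
  · exact h.2
  · rw [h, h]

variable (x) in
/-- `pullFun` as a permutation. -/
noncomputable def pull : Equiv.Perm V := (B.pullFun_involutive (x := x)).toPerm

theorem pull_pull (v : V) : B.pull x (B.pull x v) = v := B.pullFun_involutive v

theorem pull_cases (v : V) :
    B.Pulls x v (B.pull x v) ∨ B.Pulls x (B.pull x v) v ∨ B.pull x v = v := by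
  obtain h | h | h := B.pullFun_cases (x := x) v
  · exact Or.inl h.1
  · exact Or.inr (Or.inl h.1)
  · exact Or.inr (Or.inr h)

theorem Pulls.adj {B : Branching G} {v w : V} (h : B.Pulls x v w) : G.Adj v w :=
  h.2.2.2.1 ▸ (B.adj_par w h.2.2.1).symm

theorem Pulls.c_eq {B : Branching G} {v w : V} (h : B.Pulls x v w) : B.c v = B.c w := by
  obtain ⟨hv, -, hw, rfl, -⟩ := h
  exact B.c_par w hw hv

theorem isRound_pull : isRound G (B.pull x) := by
  refine ⟨Equiv.ext B.pull_pull, fun v hv => ?_⟩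
  obtain h | h | h := B.pull_cases (x := x) v
  · exact h.adj
  · exact h.adj.symm
  · exact absurd h hv

theorem c_pull (v : V) : B.c (B.pull x v) = B.c v := by
  obtain h | h | h := B.pull_cases (x := x) v
  · exact h.c_eq.symm
  · exact h.c_eq
  · rw [h]

theorem pull_z : B.pull x B.z = B.z := by
  rw [← B.c_eq_z, B.c_pull, B.c_root]

theorem d_pull_le {v : V} (hv : x v ≠ B.c v) : B.d (B.pull x v) ≤ B.d v := by
  obtain h | h | h := B.pull_cases (x := x) v
  · exact absurd h.2.1 hv
  · have := B.d_par v h.2.2.1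
    rw [h.2.2.2.1] at this
    omega
  · rw [h]

theorem pull_top {r : V} (hr : B.par r = B.z) (hx : x r ≠ B.c r) : B.pull x r = r := by
  obtain h | h | h := B.pull_cases (x := x) r
  · exact absurd h.2.1 hx
  · exact absurd (h.2.2.2.1.symm.trans hr) h.1
  · exact h

theorem exists_d_pull_lt {w : V} (hw : w ≠ B.z) (hp : B.par w ≠ B.z) (hxw : x w ≠ B.c w)
    (hxp : x (B.par w) = B.c w) :
    ∃ u, B.c u = B.c w ∧ x u ≠ B.c u ∧ B.d u = B.d w ∧ B.d (B.pull x u) + 1 = B.d w := by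
  have h : B.Pulls x (B.par w) w := ⟨hp, by rw [hxp, B.c_par w hw hp], hw, rfl, hxw⟩
  have h2 := (B.pullFun_of_exists ⟨w, h⟩).2.1
  have h3 := B.d_par w hw
  have h4 := B.d_par _ h2.2.2.1
  rw [h2.2.2.2.1] at h4
  refine ⟨B.pullFun x (B.par w), h2.c_eq.symm.trans h.c_eq, h2.2.2.2.2, by omega, ?_⟩
  rw [show B.pull x (B.pullFun x (B.par w)) = B.par w from B.pull_pull _]
  exact h3

end Pull

theorem exists_d_eq {r : V} (hr : r ≠ B.z) {v : V} (hv : B.c v = r) {k : ℕ} (hk : 0 < k)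
    (hkv : k ≤ B.d v) : ∃ w, B.c w = r ∧ B.d w = k := by
  have hvz : v ≠ B.z := by
    rintro rfl
    exact hr (by rw [← hv, B.c_root])
  revert hv hkv
  refine B.par_induction (P := fun v => B.c v = r → k ≤ B.d v → ∃ w, B.c w = r ∧ B.d w = k)
    ?_ ?_ v hvz
  · intro v hv hp hc hd
    have := (B.par_eq_z_iff hv).mp hp
    exact ⟨v, hc, by omega⟩
  · intro v hv hp ih hc hd
    obtain h | h := hd.eq_or_lt
    · exact ⟨v, hc, h.symm⟩
    · have := B.d_par v hv
      exact ih (by rw [B.c_par v hv hp, hc]) (by omega)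

theorem isRound_pull_mul_swap [DecidableEq V] {x : V → V} {r : V} (hrz : r ≠ B.z)
    (hcr : B.c r = r) (hxr : x r ≠ r) :
    isRound G (B.pull x * Equiv.swap B.z r) := by
  have hp : B.par r = B.z := by
    have := (B.par_c hrz).2
    rwa [hcr] at this
  have h1 : B.pull x B.z = B.z := B.pull_z
  have h2 : B.pull x r = r := B.pull_top hp (by rwa [hcr])
  have h3 : B.pull x * Equiv.swap B.z r = Equiv.swap B.z r * B.pull x := by
    rw [Equiv.mul_swap_eq_swap_mul, h1, h2]
  have hadj : G.Adj r B.z := hp ▸ B.adj_par r hrz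
  refine ⟨?_, fun v hv => ?_⟩
  · calc B.pull x * Equiv.swap B.z r * (B.pull x * Equiv.swap B.z r)
        = B.pull x * Equiv.swap B.z r * (Equiv.swap B.z r * B.pull x) := by rw [← h3]
      _ = B.pull x * (Equiv.swap B.z r * Equiv.swap B.z r) * B.pull x := by
          simp only [mul_assoc]
      _ = 1 := by rw [Equiv.swap_mul_self, mul_one, B.isRound_pull.1]
  · rw [Equiv.Perm.mul_apply] at hv ⊢
    by_cases hvz : v = B.z
    · rw [hvz, Equiv.swap_apply_left, h2]
      exact hadj.symm
    by_cases hvr : v = r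
    · rw [hvr, Equiv.swap_apply_right, h1]
      exact hadj
    rw [Equiv.swap_apply_of_ne_of_ne hvz hvr] at hv ⊢
    exact B.isRound_pull.2 v hv

variable [Fintype V] [DecidableEq V]

/-- The vertices of the branch `r` holding a pebble of another colour. -/
def misplaced (x : V → V) (r : V) : Finset V :=
  Finset.univ.filter fun v => B.c v = r ∧ x v ≠ r

/-- The misplaced vertices of the branch `r` at depth at most `D`. -/
def misplacedUpTo (x : V → V) (r : V) (D : ℕ) : Finset V :=
  Finset.univ.filter fun v => B.c v = r ∧ x v ≠ r ∧ B.d v ≤ D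

/-- After `K` more rounds of pulling, the branch `r` can deliver a misplaced pebble at its top
every other round. -/
def Ready (x : V → V) (r : V) (K : ℕ) : Prop :=
  ∀ i, min (B.misplaced x r).card (i + 1) ≤ (B.misplacedUpTo x r (K + 2 * i + 1)).card

variable {B} {x : V → V} {r : V}

theorem mem_misplaced {v : V} : v ∈ B.misplaced x r ↔ B.c v = r ∧ x v ≠ r := by
  simp [misplaced]

theorem mem_misplacedUpTo {v : V} {D : ℕ} :
    v ∈ B.misplacedUpTo x r D ↔ B.c v = r ∧ x v ≠ r ∧ B.d v ≤ D := by
  simp [misplacedUpTo]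

theorem misplacedUpTo_mono {D E : ℕ} (h : D ≤ E) :
    B.misplacedUpTo x r D ⊆ B.misplacedUpTo x r E := by
  intro v hv
  rw [mem_misplacedUpTo] at hv ⊢
  exact ⟨hv.1, hv.2.1, hv.2.2.trans h⟩

theorem Ready.mono {K L : ℕ} (h : K ≤ L) (hx : B.Ready x r K) : B.Ready x r L :=
  fun i => (hx i).trans (Finset.card_le_card (misplacedUpTo_mono (by omega)))

theorem card_misplaced_pull : (B.misplaced (x ∘ B.pull x) r).card = (B.misplaced x r).card := by
  refine Finset.card_bij (fun v _ => B.pull x v) ?_ ?_ ?_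
  · intro v hv
    rw [mem_misplaced] at hv ⊢
    rwa [B.c_pull]
  · intro v _ w _ h
    exact (B.pull x).injective h
  · intro v hv
    rw [mem_misplaced] at hv
    refine ⟨B.pull x v, ?_, B.pull_pull v⟩
    rw [mem_misplaced, B.c_pull, Function.comp_apply, B.pull_pull]
    exact hv

/-- The misplaced pebbles never move down. -/
theorem image_pull_subset (D : ℕ) :
    (B.misplacedUpTo x r D).image (B.pull x) ⊆ B.misplacedUpTo (x ∘ B.pull x) r D := by
  intro u hu
  obtain ⟨v, hv, rfl⟩ := Finset.mem_image.mp hu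
  rw [mem_misplacedUpTo] at hv ⊢
  obtain ⟨hc, hx, hd⟩ := hv
  rw [B.c_pull, Function.comp_apply, B.pull_pull]
  exact ⟨hc, hx, (B.d_pull_le (by rwa [hc])).trans hd⟩

theorem card_misplacedUpTo_le_pull (D : ℕ) :
    (B.misplacedUpTo x r D).card ≤ (B.misplacedUpTo (x ∘ B.pull x) r D).card := by
  rw [← Finset.card_image_of_injective _ (B.pull x).injective]
  exact Finset.card_le_card (image_pull_subset D)

theorem card_misplacedUpTo_lt_pull {D : ℕ} {u : V} (hc : B.c u = r) (hx : x u ≠ r)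
    (hd : B.d u = D + 1) (hp : B.d (B.pull x u) ≤ D) :
    (B.misplacedUpTo x r D).card < (B.misplacedUpTo (x ∘ B.pull x) r D).card := by
  have hu : u ∉ B.misplacedUpTo x r D := fun h => by
    have := (mem_misplacedUpTo.mp h).2.2
    omega
  rw [Nat.lt_iff_add_one_le, ← Finset.card_insert_of_notMem hu,
    ← Finset.card_image_of_injective _ (B.pull x).injective, Finset.image_insert]
  refine Finset.card_le_card (Finset.insert_subset ?_ (image_pull_subset D))
  rw [mem_misplacedUpTo, B.c_pull, Function.comp_apply, B.pull_pull]
  exact ⟨hc, hx, hp⟩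

theorem Ready.card_pull (hr : r ≠ B.z) {K : ℕ} (h : B.Ready x r K) {i : ℕ} (hi : 1 ≤ K + 2 * i) :
    min (B.misplaced x r).card (i + 1) ≤
      (B.misplacedUpTo (x ∘ B.pull x) r (K + 2 * i)).card := by
  by_cases hN : min (B.misplaced x r).card (i + 1) ≤ (B.misplacedUpTo x r (K + 2 * i)).card
  · exact hN.trans (card_misplacedUpTo_le_pull _)
  have hne : ∀ u, B.c u = r → u ≠ B.z := by
    rintro u hu rfl
    exact hr (by rw [← hu, B.c_root])
  have hi1 := h i
  obtain ⟨w, hw, hw'⟩ := Finset.exists_mem_notMem_of_card_lt_card ((not_le.mp hN).trans_le hi1)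
  rw [mem_misplacedUpTo] at hw hw'
  obtain ⟨hwc, hwx, hwd⟩ := hw
  have hwd' : B.d w = K + 2 * i + 1 := by
    by_contra hd
    exact hw' ⟨hwc, hwx, by omega⟩
  have hlow : min (B.misplaced x r).card (i + 1) ≤ (B.misplacedUpTo x r (K + 2 * i)).card + 1 ∧
      ∀ u, B.c u = r → x u ≠ r → B.d u ≠ K + 2 * i := by
    rcases i with _ | i
    · refine ⟨by omega, fun u hu hxu hdu => hN ?_⟩
      have : 0 < (B.misplacedUpTo x r (K + 2 * 0)).card :=
        Finset.card_pos.mpr ⟨u, mem_misplacedUpTo.mpr ⟨hu, hxu, hdu.le⟩⟩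
      omega
    · have h2 := h i
      have h3 := Finset.card_le_card
        (misplacedUpTo_mono (B := B) (x := x) (r := r)
          (show K + 2 * i + 1 ≤ K + 2 * (i + 1) by omega))
      refine ⟨by omega, fun u hu hxu hdu => hN ?_⟩
      have h4 : (B.misplacedUpTo x r (K + 2 * i + 1)).card <
          (B.misplacedUpTo x r (K + 2 * (i + 1))).card := by
        refine Finset.card_lt_card (Finset.ssubset_iff_of_subset
          (misplacedUpTo_mono (by omega)) |>.mpr ⟨u, ?_, ?_⟩)
        · exact mem_misplacedUpTo.mpr ⟨hu, hxu, hdu.le⟩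
        · intro hu'
          have := (mem_misplacedUpTo.mp hu').2.2
          omega
      omega
  have hwz := hne w hwc
  have hdp := B.d_par w hwz
  have hpz : B.par w ≠ B.z := by
    rw [Ne, B.par_eq_z_iff hwz]
    omega
  have hpc : B.c (B.par w) = r := (B.c_par w hwz hpz).trans hwc
  have hpx : x (B.par w) = r := by
    by_contra hpx
    exact hlow.2 _ hpc hpx (by omega)
  obtain ⟨u, huc, hux, hud, hup⟩ :=
    B.exists_d_pull_lt hwz hpz (by rwa [hwc]) (by rw [hpx, hwc])
  have hur : B.c u = r := huc.trans hwc
  have := card_misplacedUpTo_lt_pull (D := K + 2 * i) hur (hur ▸ hux) (by omega) (by omega)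
  omega

theorem Ready.pull (hr : r ≠ B.z) {K : ℕ} (h : B.Ready x r (K + 1)) :
    B.Ready (x ∘ B.pull x) r K := by
  intro i
  rw [card_misplaced_pull]
  have := h.card_pull hr (i := i) (by omega)
  rwa [show K + 2 * i + 1 = K + 1 + 2 * i by omega]

theorem Ready.misplaced_top (h : B.Ready x r 0) (ha : (B.misplaced x r).Nonempty)
    (hr : r ≠ B.z) : x r ≠ r ∧ B.c r = r := by
  have h0 := h 0
  have h1 := ha.card_pos
  obtain ⟨v, hv⟩ := Finset.card_pos.mp
    (show 0 < (B.misplacedUpTo x r (0 + 2 * 0 + 1)).card by omega)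
  obtain ⟨hc, hx, hd⟩ := mem_misplacedUpTo.mp hv
  have hvz : v ≠ B.z := by
    rintro rfl
    exact hr (by rw [← hc, B.c_root])
  have hv1 := B.d_pos hvz
  have hvr : v = r := by
    rw [← hc]
    exact (B.c_top v hvz ((B.par_eq_z_iff hvz).mpr (by omega))).symm
  subst hvr
  exact ⟨hx, hc⟩

theorem ready_of_card (hr : r ≠ B.z) {K : ℕ}
    (hK : (Finset.univ.filter fun v => B.c v = r).card ≤ K + (B.misplaced x r).card) :
    B.Ready x r K := by
  intro i
  by_cases hdeep : ∃ v, B.c v = r ∧ K + 2 * i + 1 < B.d v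
  · obtain ⟨v, hv, hvd⟩ := hdeep
    have h1 : (Finset.Icc 1 (K + 2 * i + 1)).card ≤
        (Finset.univ.filter fun v => B.c v = r ∧ B.d v ≤ K + 2 * i + 1).card := by
      refine Finset.card_le_card_of_surjOn B.d ?_
      intro k hk
      rw [Finset.mem_coe, Finset.mem_Icc] at hk
      obtain ⟨w, hw, hwk⟩ := B.exists_d_eq hr hv (k := k) (by omega) (by omega)
      refine ⟨w, ?_, hwk⟩
      simp only [Finset.coe_filter, Finset.mem_univ, true_and, Set.mem_ofPred_eq]
      exact ⟨hw, by omega⟩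
    have h2 : (B.misplaced x r \ B.misplacedUpTo x r (K + 2 * i + 1)).card ≤
        (Finset.univ.filter fun v => B.c v = r ∧ ¬ B.d v ≤ K + 2 * i + 1).card := by
      refine Finset.card_le_card fun u hu => ?_
      rw [Finset.mem_sdiff, mem_misplaced, mem_misplacedUpTo] at hu
      simp only [Finset.mem_filter, Finset.mem_univ, true_and]
      tauto
    have h3 := Finset.card_filter_add_card_filter_not
      (s := Finset.univ.filter fun v => B.c v = r) (fun v => B.d v ≤ K + 2 * i + 1)
    rw [Finset.filter_filter, Finset.filter_filter] at h3
    have h4 := Finset.le_card_sdiff (B.misplacedUpTo x r (K + 2 * i + 1)) (B.misplaced x r)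
    rw [Nat.card_Icc] at h1
    omega
  · refine (min_le_left _ _).trans (Finset.card_le_card fun v hv => ?_)
    rw [mem_misplaced] at hv
    rw [mem_misplacedUpTo]
    refine ⟨hv.1, hv.2, ?_⟩
    by_contra hd
    exact hdeep ⟨v, hv.1, by omega⟩

end Branching

/-- `ColorRoutes G k x y`: the colouring `x` of the pebbles is turned into `y` by `k` rounds. -/
def ColorRoutes {V ι : Type*} (G : SimpleGraph V) (k : ℕ) (x y : V → ι) : Prop :=
  ∃ π, Routes G k π ∧ x = y ∘ π

namespace ColorRoutes

variable {V ι : Type*} {G : SimpleGraph V}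

theorem refl (x : V → ι) : ColorRoutes G 0 x x := ⟨1, Routes.one 0, rfl⟩

theorem trans {k m : ℕ} {x y w : V → ι} (hxy : ColorRoutes G k x y) (hyw : ColorRoutes G m y w) :
    ColorRoutes G (m + k) x w := by
  obtain ⟨π, hπ, rfl⟩ := hxy
  obtain ⟨ρ, hρ, rfl⟩ := hyw
  exact ⟨ρ * π, hρ.mul hπ, rfl⟩

theorem of_isRound {σ : Equiv.Perm V} (hσ : isRound G σ) (x : V → ι) :
    ColorRoutes G 1 x (x ∘ σ) := by
  refine ⟨σ, Routes.of_isRound hσ, funext fun v => ?_⟩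
  exact congrArg x (Equiv.congr_fun hσ.1 v).symm

end ColorRoutes

namespace Branching

variable {V : Type*} {G : SimpleGraph V} {B : Branching G} [Fintype V] [DecidableEq V]
  {x y : V → V} {r : V}

variable (B) in
/-- Each colour occurs as often as there are vertices in the branch of that colour. -/
def Balanced (x : V → V) : Prop :=
  ∀ r, (Finset.univ.filter fun v => x v = r).card = (Finset.univ.filter fun v => B.c v = r).card

variable (B) in
/-- The number of pebbles off the root that are not in their branch. -/
def total (x : V → V) : ℕ := ∑ r ∈ Finset.univ.erase B.z, (B.misplaced x r).card

theorem card_filter_comp_perm (x : V → V) (π : Equiv.Perm V) (r : V) :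
    (Finset.univ.filter fun v => (x ∘ π) v = r).card =
      (Finset.univ.filter fun v => x v = r).card :=
  Finset.card_equiv π (by simp)

theorem Balanced.of_colorRoutes (hx : B.Balanced x) {k : ℕ} (h : ColorRoutes G k x y) :
    B.Balanced y := by
  obtain ⟨π, -, rfl⟩ := h
  intro r
  rw [← hx r, card_filter_comp_perm]

theorem Balanced.misplaced_nonempty (hx : B.Balanced x) {u : V} (hu : x u = r)
    (hc : B.c u ≠ r) : (B.misplaced x r).Nonempty := by
  by_contra hne
  have hsub : (Finset.univ.filter fun v => B.c v = r) ⊆ Finset.univ.filter fun v => x v = r := by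
    intro v hv
    simp only [Finset.mem_filter, Finset.mem_univ, true_and] at hv ⊢
    by_contra hxv
    exact hne ⟨v, mem_misplaced.mpr ⟨hv, hxv⟩⟩
  have heq := Finset.eq_of_subset_of_card_le hsub (hx r).le
  have hu' : u ∈ Finset.univ.filter fun v => x v = r := by simp [hu]
  rw [← heq] at hu'
  exact hc (by simpa using hu')

theorem card_root_branch : (Finset.univ.filter fun v => B.c v = B.z).card = 1 := by
  rw [Finset.card_eq_one]
  exact ⟨B.z, by ext v; simp [B.c_eq_z]⟩

theorem Balanced.eq_of_eq_root (hx : B.Balanced x) {u v : V} (hu : x u = B.z) (hv : x v = B.z) :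
    u = v := by
  have h := (hx B.z).trans card_root_branch
  exact Finset.card_le_one.mp h.le u (by simp [hu]) v (by simp [hv])

theorem Ready.congr {K : ℕ} (h : ∀ v, B.c v = r → (x v ≠ r ↔ y v ≠ r)) (hx : B.Ready x r K) :
    B.Ready y r K := by
  have h1 : B.misplaced x r = B.misplaced y r :=
    Finset.filter_congr fun v _ => and_congr_right (h v)
  have h2 : ∀ D, B.misplacedUpTo x r D = B.misplacedUpTo y r D := fun D =>
    Finset.filter_congr fun v _ => and_congr_right fun hv => and_congr_left' (h v hv)
  intro i
  rw [← h1, ← h2]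
  exact hx i

theorem Ready.pull_erase_top (hrz : r ≠ B.z) (hr : B.Ready x r 0)
    (h : ∀ v, B.c v = r → (y v ≠ r ↔ v ≠ r ∧ x (B.pull x v) ≠ r)) : B.Ready y r 1 := by
  have h1 : B.misplaced y r = (B.misplaced (x ∘ B.pull x) r).erase r := by
    ext v
    rw [Finset.mem_erase, mem_misplaced, mem_misplaced, Function.comp_apply]
    have := h v
    tauto
  have h2 : ∀ D, B.misplacedUpTo y r D = (B.misplacedUpTo (x ∘ B.pull x) r D).erase r := by
    intro D
    ext v
    rw [Finset.mem_erase, mem_misplacedUpTo, mem_misplacedUpTo, Function.comp_apply]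
    have := h v
    tauto
  intro i
  have h3 := hr.card_pull hrz (i := i + 1) (by omega)
  by_cases hmem : r ∈ B.misplaced (x ∘ B.pull x) r
  · rw [h1, h2, Finset.card_erase_of_mem hmem, card_misplaced_pull]
    have h4 := Finset.pred_card_le_card_erase
      (s := B.misplacedUpTo (x ∘ B.pull x) r (1 + 2 * i + 1)) (a := r)
    rw [show 0 + 2 * (i + 1) = 1 + 2 * i + 1 by omega] at h3
    omega
  · have hmem' : r ∉ B.misplacedUpTo (x ∘ B.pull x) r (1 + 2 * i + 1) := by
      rw [mem_misplacedUpTo]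
      rw [mem_misplaced] at hmem
      tauto
    rw [h1, h2, Finset.erase_eq_of_notMem hmem, Finset.erase_eq_of_notMem hmem',
      card_misplaced_pull]
    rw [show 0 + 2 * (i + 1) = 1 + 2 * i + 1 by omega] at h3
    omega

/-- One round that swaps the pebbles at the root and at the top of branch `r`, and pulls misplaced
pebbles upwards everywhere else. -/
theorem exists_exchange (hrz : r ≠ B.z) (hcr : B.c r = r) (hxr : x r ≠ r)
    (hr0 : B.Ready x r 0) (h1 : ∀ k, k ≠ B.z → B.Ready x k 1) :
    ∃ y, ColorRoutes G 1 x y ∧ y B.z = x r ∧ y r = x B.z ∧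
      (∀ k, k ≠ B.z → k ≠ r → B.Ready y k 0) ∧
      (x B.z = r → B.Ready y r 1 ∧ B.total y + 1 = B.total x) ∧
      (x B.z ≠ r → B.Ready y r 0 ∧ B.total y = B.total x) := by
  have hp : B.par r = B.z := by
    have := (B.par_c hrz).2
    rwa [hcr] at this
  have hpr : B.pull x r = r := B.pull_top hp (by rwa [hcr])
  have hpz : B.pull x B.z = B.z := B.pull_z
  have hy : ∀ v, v ≠ B.z → v ≠ r →
      (x ∘ (B.pull x * Equiv.swap B.z r : Equiv.Perm V)) v = x (B.pull x v) := by
    intro v hvz hvr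
    rw [Function.comp_apply, Equiv.Perm.mul_apply, Equiv.swap_apply_of_ne_of_ne hvz hvr]
  have hyz : (x ∘ (B.pull x * Equiv.swap B.z r : Equiv.Perm V)) B.z = x r := by
    rw [Function.comp_apply, Equiv.Perm.mul_apply, Equiv.swap_apply_left, hpr]
  have hyr : (x ∘ (B.pull x * Equiv.swap B.z r : Equiv.Perm V)) r = x B.z := by
    rw [Function.comp_apply, Equiv.Perm.mul_apply, Equiv.swap_apply_right, hpz]
  have hround := ColorRoutes.of_isRound (B.isRound_pull_mul_swap hrz hcr hxr) x
  generalize x ∘ (B.pull x * Equiv.swap B.z r : Equiv.Perm V) = y at hy hyz hyr hround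
  have hvz : ∀ k, k ≠ B.z → ∀ v, B.c v = k → v ≠ B.z := by
    rintro k hk v hv rfl
    exact hk (by rw [← hv, B.c_root])
  have hother : ∀ k, k ≠ B.z → k ≠ r → ∀ v, B.c v = k → ((x ∘ B.pull x) v ≠ k ↔ y v ≠ k) := by
    intro k hk hkr v hv
    rw [hy v (hvz k hk v hv) (by rintro rfl; exact hkr (by rw [← hv, hcr])),
      Function.comp_apply]
  have hcard : ∀ k, k ≠ B.z → (∀ v, B.c v = k → ((x ∘ B.pull x) v ≠ k ↔ y v ≠ k)) →
      (B.misplaced y k).card = (B.misplaced x k).card := by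
    intro k hk h
    rw [← card_misplaced_pull (x := x)]
    exact congrArg Finset.card (Finset.filter_congr fun v _ => and_congr_right (h v)).symm
  have hmem : r ∈ Finset.univ.erase B.z := by simp [hrz]
  have hrest : ∑ k ∈ (Finset.univ.erase B.z).erase r, (B.misplaced y k).card =
      ∑ k ∈ (Finset.univ.erase B.z).erase r, (B.misplaced x k).card := by
    refine Finset.sum_congr rfl fun k hk => ?_
    simp only [Finset.mem_erase, Finset.mem_univ, and_true] at hk
    exact hcard k hk.2 (hother k hk.2 hk.1)
  refine ⟨y, hround, hyz, hyr, fun k hk hkr => ((h1 k hk).pull hk).congr (hother k hk hkr), ?_, ?_⟩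
  · intro hxz
    have hiff : ∀ v, B.c v = r → (y v ≠ r ↔ v ≠ r ∧ x (B.pull x v) ≠ r) := by
      intro v hv
      by_cases hvr : v = r
      · simp [hvr, hyr, hxz]
      · simp [hvr, hy v (hvz r hrz v hv) hvr]
    refine ⟨hr0.pull_erase_top hrz hiff, ?_⟩
    have herase : B.misplaced y r = (B.misplaced (x ∘ B.pull x) r).erase r := by
      ext v
      rw [Finset.mem_erase, mem_misplaced, mem_misplaced, Function.comp_apply]
      have := hiff v
      tauto
    have hr : r ∈ B.misplaced (x ∘ B.pull x) r := by
      rw [mem_misplaced, Function.comp_apply, hpr]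
      exact ⟨hcr, hxr⟩
    have := Finset.card_erase_add_one hr
    rw [← herase, card_misplaced_pull] at this
    unfold total
    rw [← Finset.add_sum_erase _ _ hmem, ← Finset.add_sum_erase _ _ hmem, hrest]
    omega
  · intro hxz
    have hiff : ∀ v, B.c v = r → ((x ∘ B.pull x) v ≠ r ↔ y v ≠ r) := by
      intro v hv
      by_cases hvr : v = r
      · simp [hvr, hyr, hxz, hpr, hxr]
      · rw [hy v (hvz r hrz v hv) hvr, Function.comp_apply]
    refine ⟨((h1 r hrz).pull hrz).congr hiff, ?_⟩
    unfold total
    rw [← Finset.add_sum_erase _ _ hmem, ← Finset.add_sum_erase _ _ hmem, hrest,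
      hcard r hrz hiff]

/-- If the pebble at the root belongs to a branch that is ready, one round delivers it. -/
theorem Balanced.exists_deliver (hx : B.Balanced x) (hxz : x B.z ≠ B.z)
    (hr0 : B.Ready x (x B.z) 0) (h1 : ∀ k, k ≠ B.z → B.Ready x k 1) :
    ∃ y, ColorRoutes G 1 x y ∧ B.Balanced y ∧ y B.z = x (x B.z) ∧ y B.z ≠ x B.z ∧
      (∀ k, k ≠ B.z → B.Ready y k 1) ∧ (∀ k, k ≠ B.z → k ≠ x B.z → B.Ready y k 0) ∧
      B.total y + 1 = B.total x := by
  have hne := hx.misplaced_nonempty (r := x B.z) rfl (by rw [B.c_root]; exact hxz.symm)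
  obtain ⟨hxr, hcr⟩ := hr0.misplaced_top hne hxz
  obtain ⟨y, hround, hyz, -, hy0, hy1, -⟩ := exists_exchange hxz hcr hxr hr0 h1
  refine ⟨y, hround, hx.of_colorRoutes hround, hyz, hyz ▸ hxr, fun k hk => ?_, hy0, (hy1 rfl).2⟩
  by_cases hkr : k = x B.z
  · exact hkr ▸ (hy1 rfl).1
  · exact (hy0 k hk hkr).mono (Nat.zero_le 1)

theorem eq_c_of_total_eq_zero (hx : x B.z = B.z) (h : B.total x = 0) : x = B.c := by
  funext v
  by_cases hv : v = B.z
  · rw [hv, hx, B.c_root]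
  by_contra hxv
  have := (Finset.sum_eq_zero_iff.mp h) (B.c v) (by simp [B.c_eq_z, hv])
  rw [Finset.card_eq_zero] at this
  have hmem : v ∈ B.misplaced x (B.c v) := mem_misplaced.mpr ⟨rfl, hxv⟩
  simp [this] at hmem

/-- If the root's pebble is home but some pebble is misplaced, then at least two branches contain
misplaced pebbles. -/
theorem Balanced.exists_misplaced_ne (hx : B.Balanced x) (hxz : x B.z = B.z)
    (h : B.total x ≠ 0) (last : V) :
    ∃ r, r ≠ B.z ∧ r ≠ last ∧ (B.misplaced x r).Nonempty := by
  obtain ⟨k, hk, hk'⟩ := Finset.exists_ne_zero_of_sum_ne_zero h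
  obtain ⟨u, hu⟩ := Finset.card_pos.mp (Nat.pos_of_ne_zero hk')
  have hkz : k ≠ B.z := Finset.ne_of_mem_erase hk
  by_cases hkl : k = last
  swap
  · exact ⟨k, hkz, hkl, ⟨u, hu⟩⟩
  rw [mem_misplaced] at hu
  refine ⟨x u, ?_, hkl ▸ hu.2, hx.misplaced_nonempty rfl (by rw [hu.1]; exact hu.2.symm)⟩
  intro hxu
  rw [hx.eq_of_eq_root hxu hxz, B.c_root] at hu
  exact hkz hu.1.symm

/-- `last` is the branch that may have received a pebble in the previous round. -/
theorem exchange_phase (m : ℕ) : ∀ (x : V → V) (last : V), B.Balanced x → B.total x = m →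
    (∀ k, k ≠ B.z → B.Ready x k 1) → (∀ k, k ≠ B.z → k ≠ last → B.Ready x k 0) →
    (x B.z = B.z → ∃ k, 2 * k ≤ 3 * m ∧ ColorRoutes G k x B.c) ∧
      (x B.z ≠ B.z → x B.z ≠ last → ∃ k, 2 * k + 1 ≤ 3 * m ∧ ColorRoutes G k x B.c) := by
  induction m with
  | zero =>
    intro x last hx hm h1 h0
    refine ⟨fun hxz => ⟨0, le_rfl, ?_⟩, fun hxz hl => ?_⟩
    · rw [eq_c_of_total_eq_zero hxz hm]
      exact ColorRoutes.refl _
    · obtain ⟨y, -, -, -, -, -, -, ht⟩ := hx.exists_deliver hxz (h0 _ hxz hl) h1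
      omega
  | succ m ih =>
    intro x last hx hm h1 h0
    refine ⟨fun hxz => ?_, fun hxz hl => ?_⟩
    · obtain ⟨r, hrz, hrl, hne⟩ := hx.exists_misplaced_ne hxz (by omega) last
      obtain ⟨hxr, hcr⟩ := (h0 r hrz hrl).misplaced_top hne hrz
      obtain ⟨y, hxy, hyz, hyr, hy0, -, hy1⟩ := exists_exchange hrz hcr hxr (h0 r hrz hrl) h1
      obtain ⟨hyr0, hty⟩ := hy1 (by rw [hxz]; exact hrz.symm)
      have hy := hx.of_colorRoutes hxy
      have hyall : ∀ k, k ≠ B.z → B.Ready y k 0 := by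
        intro k hk
        by_cases hkr : k = r
        · exact hkr ▸ hyr0
        · exact hy0 k hk hkr
      rw [hxz] at hyr
      have hyzz : y B.z ≠ B.z := fun h => hrz (hy.eq_of_eq_root hyr h)
      obtain ⟨w, hyw, hw, hwz, hwne, hw1, hw0, htw⟩ := hy.exists_deliver hyzz (hyall _ hyzz)
        fun k hk => (hyall k hk).mono (Nat.zero_le 1)
      have hwzz : w B.z ≠ B.z := by
        intro h
        rw [hwz] at h
        exact hxr (hyz.symm.trans (hy.eq_of_eq_root h hyr))
      obtain ⟨k, hk, hwc⟩ := (ih w (y B.z) hw (by omega) hw1 hw0).2 hwzz hwne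
      exact ⟨k + 1 + 1, by omega, hxy.trans (hyw.trans hwc)⟩
    · obtain ⟨y, hxy, hy, -, hne, hy1, hy0, ht⟩ := hx.exists_deliver hxz (h0 _ hxz hl) h1
      have key := ih y (x B.z) hy (by omega) hy1 hy0
      by_cases hyz : y B.z = B.z
      · obtain ⟨k, hk, hyc⟩ := key.1 hyz
        exact ⟨k + 1, by omega, hxy.trans hyc⟩
      · obtain ⟨k, hk, hyc⟩ := key.2 hyz hne
        exact ⟨k + 1, by omega, hxy.trans hyc⟩

theorem pull_phase (K : ℕ) : ∀ x : V → V, (∀ k, k ≠ B.z → B.Ready x k K) →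
    ∃ y, ColorRoutes G K x y ∧ (∀ k, k ≠ B.z → B.Ready y k 0) ∧ B.total y = B.total x := by
  induction K with
  | zero => exact fun x hx => ⟨x, ColorRoutes.refl x, hx, rfl⟩
  | succ K ih =>
    intro x hx
    obtain ⟨y, hy, hy0, ht⟩ := ih (x ∘ B.pull x) fun k hk => (hx k hk).pull hk
    refine ⟨y, (ColorRoutes.of_isRound B.isRound_pull x).trans hy, hy0, ht.trans ?_⟩
    exact Finset.sum_congr rfl fun k _ => card_misplaced_pull

theorem exists_pull_bound (x : V → V) :
    ∃ K, (∀ k, k ≠ B.z → B.Ready x k K) ∧ 2 * K + 3 * B.total x + 3 ≤ 3 * Fintype.card V := by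
  have hn : Fintype.card V = ∑ k, (Finset.univ.filter fun v => B.c v = k).card :=
    Finset.card_eq_sum_card_fiberwise fun _ _ => Finset.mem_univ _
  rw [← Finset.add_sum_erase _ _ (Finset.mem_univ B.z), card_root_branch] at hn
  have hle : ∀ k, (B.misplaced x k).card ≤ (Finset.univ.filter fun v => B.c v = k).card := by
    intro k
    refine Finset.card_le_card fun v hv => ?_
    simpa using (mem_misplaced.mp hv).1
  obtain hemp | hne := (Finset.univ.erase B.z).eq_empty_or_nonempty
  · refine ⟨0, fun k hk => ?_, ?_⟩
    · have : k ∈ Finset.univ.erase B.z := by simp [hk]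
      simp [hemp] at this
    · unfold total
      rw [hemp] at hn ⊢
      simp only [Finset.sum_empty] at hn ⊢
      omega
  · obtain ⟨r, hr, hmax⟩ := Finset.exists_max_image _
      (fun k => (Finset.univ.filter fun v => B.c v = k).card - (B.misplaced x k).card) hne
    refine ⟨(Finset.univ.filter fun v => B.c v = r).card - (B.misplaced x r).card,
      fun k hk => ready_of_card hk ?_, ?_⟩
    · have := hmax k (by simp [hk])
      have := hle k
      omega
    · have h1 : ∑ k ∈ (Finset.univ.erase B.z).erase r, (B.misplaced x k).card ≤
          ∑ k ∈ (Finset.univ.erase B.z).erase r,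
            (Finset.univ.filter fun v => B.c v = k).card :=
        Finset.sum_le_sum fun k _ => hle k
      have h2 := hle r
      unfold total
      rw [← Finset.add_sum_erase _ _ hr] at hn ⊢
      omega

/-- About `3 * n / 2` rounds bring every pebble into its branch. -/
theorem Balanced.exists_colorRoutes (hx : B.Balanced x) :
    ∃ k, 2 * k + 3 ≤ 3 * Fintype.card V ∧ ColorRoutes G k x B.c := by
  obtain ⟨K, hK, hbound⟩ := exists_pull_bound (B := B) x
  obtain ⟨y, hxy, hy0, ht⟩ := pull_phase K x hK
  have key := exchange_phase (B.total y) y B.z (hx.of_colorRoutes hxy) rfl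
    (fun k hk => (hy0 k hk).mono (Nat.zero_le 1)) fun k hk _ => hy0 k hk
  by_cases hyz : y B.z = B.z
  · obtain ⟨k, hk, hyc⟩ := key.1 hyz
    exact ⟨k + K, by omega, hxy.trans hyc⟩
  · obtain ⟨k, hk, hyc⟩ := key.2 hyz hyz
    exact ⟨k + K, by omega, hxy.trans hyc⟩

end Branching

theorem SimpleGraph.Connected.routes (n : ℕ) : ∀ {V : Type*} [Fintype V] [DecidableEq V]
    {G : SimpleGraph V}, G.Connected → Fintype.card V = n → ∀ π : Equiv.Perm V,
      Routes G (3 * n) π := by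
  induction n using Nat.strong_induction_on with
  | _ n ih =>
    intro V _ _ G hG hn π
    obtain ⟨B, hB⟩ := hG.exists_balanced_branching
    have hbal : B.Balanced (B.c ∘ π) := Branching.card_filter_comp_perm B.c π
    obtain ⟨k, hk, ρ, hρ, hc⟩ := hbal.exists_colorRoutes
    have hτ : Routes G (3 * (n / 2)) (π * ρ⁻¹) := by
      refine routes_of_fibers B.c (fun v => ?_) fun r σ => ?_
      · simpa using congrFun hc (ρ⁻¹ v)
      · by_cases hr : r = B.z
        · have : Subsingleton {v // B.c v = r} := by
            subst hr
            exact ⟨fun u v => Subtype.ext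
              ((B.c_eq_z.mp u.2).trans (B.c_eq_z.mp v.2).symm)⟩
          rw [Subsingleton.elim σ 1]
          exact Routes.one _
        obtain hemp | hne := isEmpty_or_nonempty {v // B.c v = r}
        · rw [Subsingleton.elim σ 1]
          exact Routes.one _
        have hcard := hB r hr
        rw [← Fintype.card_subtype, hn] at hcard
        refine Routes.mono ?_ (ih _ ?_ (B.connected_branch hr hne) rfl σ)
        · omega
        · omega
    have := hτ.mul hρ
    rw [inv_mul_cancel_right] at this
    exact this.mono (by omega)

/-- For every finite connected graph `G` on `n` vertices, `rt(G) ≤ 3 * n`. -/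
theorem rt_le_three_mul_card
    {V : Type*} [Fintype V] [DecidableEq V] (G : SimpleGraph V) (hG : G.Connected) :
    rt G ≤ 3 * Fintype.card V := by
  refine Finset.sup_le fun π _ => ?_
  obtain ⟨L, hL, hr, hπ⟩ := hG.routes _ rfl π
  exact Nat.sInf_le ⟨L, hL, hr, hπ⟩
end
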